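/- Let a and m be positive integers. There exists an infinite set S of pairs (t,r) of non-negative integers with r < t such that: (a) for every (t,r) ∈ S and every non-negative integer n, m divides M(a; tn+r); and (b) the progressions are pairwise non-nested, i.e., for distinct (t,r), (t′,r′) ∈ S the set {tn+r : n ∈ ℕ} is not contained in {t′n+r′ : n ∈ ℕ}. The same statement holds with M(a;·) replaced by MO(a;·). -/

import Mathlib

open Finset

/-- `MO a n` is MacMahon's coefficient: the sum of the products `s_1 ⋯ s_a` over all
strictly increasing tuples `0 < k_1 < ⋯ < k_a` of positive integers and positive
integers `s_1, …, s_a` with `s_1*k_1 + ⋯ + s_a*k_a = n` (all such data satisfy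
`k_i, s_i ≤ n`, so we may sum over a finite set); in particular `MO a 0 = 0` for `a ≥ 1`. -/
def MO (a n : ℕ) : ℕ :=
  ∑ f ∈ Finset.univ.filter (fun f : Fin a → Fin (n + 1) × Fin (n + 1) =>
      (∀ i, 0 < ((f i).1 : ℕ) ∧ 0 < ((f i).2 : ℕ)) ∧
      (∀ i j : Fin a, i < j → (f i).1 < (f j).1) ∧
      (∑ i, ((f i).2 : ℕ) * ((f i).1 : ℕ)) = n),
    ∏ i, ((f i).2 : ℕ)

/-- `M a n` is the coefficient of Amdeberhan-Andrews-Tauraso: the sum of the products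
`s_1 ⋯ s_a` over all weakly increasing tuples `1 ≤ k_1 ≤ ⋯ ≤ k_a` of positive integers
and positive integers `s_1, …, s_a` with `s_1*k_1 + ⋯ + s_a*k_a = n`;
in particular `M a 0 = 0` for `a ≥ 1`. -/
def M (a n : ℕ) : ℕ :=
  ∑ f ∈ Finset.univ.filter (fun f : Fin a → Fin (n + 1) × Fin (n + 1) =>
      (∀ i, 0 < ((f i).1 : ℕ) ∧ 0 < ((f i).2 : ℕ)) ∧
      (∀ i j : Fin a, i ≤ j → (f i).1 ≤ (f j).1) ∧
      (∑ i, ((f i).2 : ℕ) * ((f i).1 : ℕ)) = n),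
    ∏ i, ((f i).2 : ℕ)

/-- The arithmetic progression `{t*n + r : n ∈ ℕ}` attached to a pair `(t, r)`. -/
def AP (p : ℕ × ℕ) : Set ℕ := {x | ∃ n : ℕ, x = p.1 * n + p.2}

open PowerSeries (X)
open scoped PowerSeries
open scoped UpperHalfPlane MatrixGroups Manifold ModularForm

/-- `ℓ` times the Hecke operator `T_ℓ` of weight `k`, acting on `q`-expansions. -/
noncomputable def hecke (l k : ℕ) : ℤ⟦X⟧ →ₗ[ℤ] ℤ⟦X⟧ where
  toFun A := PowerSeries.mk fun n ↦ l * PowerSeries.coeff (l * n) A +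
    l ^ k * (if l ∣ n then PowerSeries.coeff (n / l) A else 0)
  map_add' A B := by
    ext n
    simp only [PowerSeries.coeff_mk, map_add]
    split_ifs <;> ring
  map_smul' c A := by
    ext n
    simp only [PowerSeries.coeff_mk, map_zsmul, smul_eq_mul, RingHom.id_apply]
    split_ifs <;> ring

lemma coeff_hecke (l k n : ℕ) (A : ℤ⟦X⟧) :
    PowerSeries.coeff n (hecke l k A) = l * PowerSeries.coeff (l * n) A +
      l ^ k * (if l ∣ n then PowerSeries.coeff (n / l) A else 0) := by
  simp [hecke]

/-- The image of `A` under the Hecke operator of index `ℓ ^ (i - 1)`, scaled by `ℓ ^ (i - 1)`. -/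
noncomputable def heckePow (l k : ℕ) (A : ℤ⟦X⟧) : ℕ → ℤ⟦X⟧
  | 0 => 0
  | 1 => A
  | i + 2 => hecke l k (heckePow l k A (i + 1)) - (l ^ (k + 1) : ℤ) • heckePow l k A i

lemma coeff_heckePow {l : ℕ} (hl : 0 < l) (k : ℕ) (A : ℤ⟦X⟧) (i n : ℕ) :
    PowerSeries.coeff n (heckePow l k A (i + 1)) =
      l ^ i * PowerSeries.coeff (l ^ i * n) A +
      l ^ k * (if l ∣ n then PowerSeries.coeff (n / l) (heckePow l k A i) else 0) := by
  induction i generalizing n with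
  | zero => simp [heckePow]
  | succ i ih =>
    rw [heckePow, map_sub, coeff_hecke, ih (l * n), map_zsmul, smul_eq_mul,
      if_pos (Dvd.intro n rfl), Nat.mul_div_cancel_left _ hl, ← mul_assoc (l ^ i) l n, ← pow_succ]
    ring

lemma heckePow_mem {l k : ℕ} {L : Submodule ℤ ℤ⟦X⟧} (hL : ∀ A ∈ L, hecke l k A ∈ L)
    {A : ℤ⟦X⟧} (hA : A ∈ L) (i : ℕ) : heckePow l k A i ∈ L := by
  induction i using heckePow.induct with
  | case1 => exact L.zero_mem
  | case2 => exact hA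
  | case3 i h1 h2 => exact L.sub_mem (hL _ h1) (L.smul_mem _ h2)

lemma isTorsion_quotSMulTop (M : Type*) [AddCommGroup M] {N : ℤ} (hN : N ≠ 0) :
    Module.IsTorsion ℤ (QuotSMulTop N M) := by
  intro x
  refine ⟨⟨N, mem_nonZeroDivisors_of_ne_zero hN⟩, ?_⟩
  exact Module.mem_annihilator.mp (QuotSMulTop.mem_annihilator M N) x

/-- Modulo `N` prime to `ℓ`, the powers of a Hecke operator on a finitely generated lattice
of `q`-expansions are periodic, hence some of them vanish. -/
theorem exists_period_dvd_coeff {l k : ℕ} (hl : l.Prime) {N : ℕ} (hN : N ≠ 0)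
    (hlN : l.Coprime N) {L : Submodule ℤ ℤ⟦X⟧} (hfg : L.FG)
    (hL : ∀ A ∈ L, hecke l k A ∈ L) :
    ∃ p : ℕ, 0 < p ∧ ∀ A ∈ L, ∀ j n : ℕ, ¬ l ∣ n →
      (N : ℤ) ∣ PowerSeries.coeff (l ^ (p * (j + 1) - 1) * n) A := by
  have : Module.Finite ℤ L := Module.Finite.iff_fg.mpr hfg
  have hN' : (N : ℤ) ≠ 0 := by exact_mod_cast hN
  let Q := QuotSMulTop (N : ℤ) L
  have : Finite Q := Module.finite_of_fg_torsion Q (isTorsion_quotSMulTop L hN')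
  let T : Q →ₗ[ℤ] Q := QuotSMulTop.map (N : ℤ) ((hecke l k).restrict hL)
  let step : Q × Q → Q × Q := fun x ↦ (x.2, T x.2 - (l ^ (k + 1) : ℤ) • x.1)
  have hcop : IsCoprime ((l : ℤ) ^ (k + 1)) (N : ℤ) :=
    (Nat.isCoprime_iff_coprime.mpr hlN).pow_left
  have hinj : Function.Injective step := by
    rintro ⟨x, y⟩ ⟨x', y'⟩ h
    obtain ⟨rfl, h2⟩ := Prod.mk_inj.mp h
    have h3 : (l ^ (k + 1) : ℤ) • (x - x') = 0 := by
      rw [smul_sub, sub_eq_zero]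
      exact sub_right_injective h2
    obtain ⟨u, v, huv⟩ := hcop
    have hv : (N : ℤ) • (x - x') = 0 :=
      Module.mem_annihilator.mp (QuotSMulTop.mem_annihilator L (N : ℤ)) _
    have : x - x' = 0 := by
      rw [← one_smul ℤ (x - x'), ← huv, add_smul, mul_smul, mul_smul, h3, hv, smul_zero,
        smul_zero, add_zero]
    rw [sub_eq_zero.mp this]
  let e : Equiv.Perm (Q × Q) := Equiv.ofBijective step (Finite.injective_iff_bijective.mp hinj)
  refine ⟨orderOf e, orderOf_pos e, fun A hA j n hn ↦ ?_⟩
  let G : ℕ → Q := fun i ↦ Submodule.Quotient.mk ⟨heckePow l k A i, heckePow_mem hL hA i⟩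
  have hG : ∀ i, (e ^ i) (G 0, G 1) = (G i, G (i + 1)) := by
    intro i
    induction i with
    | zero => rfl
    | succ i ih =>
      rw [pow_succ', Equiv.Perm.mul_apply, ih]
      rfl
  obtain ⟨i, hi⟩ : ∃ i, orderOf e * (j + 1) = i + 1 :=
    Nat.exists_eq_succ_of_ne_zero (by have := orderOf_pos e; positivity)
  have hG0 : G (i + 1) = 0 := by
    have h1 := hG (i + 1)
    rw [← hi, pow_mul, pow_orderOf_eq_one, one_pow, hi] at h1
    rw [← (Prod.mk_inj.mp h1).1]
    rfl
  rw [hi, Nat.add_sub_cancel]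
  have hmem := (Submodule.Quotient.mk_eq_zero _).mp hG0
  obtain ⟨B, -, hB⟩ := (Submodule.mem_smul_pointwise_iff_exists _ _ _).mp hmem
  have hB' : (N : ℤ) • (B : ℤ⟦X⟧) = heckePow l k A (i + 1) := congrArg Subtype.val hB
  have hc := coeff_heckePow hl.pos k A i n
  rw [if_neg hn, mul_zero, add_zero, ← hB', map_zsmul, smul_eq_mul] at hc
  have hcop' : IsCoprime (N : ℤ) ((l : ℤ) ^ i) :=
    (Nat.isCoprime_iff_coprime.mpr hlN.symm).pow_right
  exact hcop'.dvd_of_dvd_mul_left ⟨_, hc.symm⟩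

section TupleSums

variable {R : Type*} [CommRing R]

lemma derivative_prod_eq {F q : ℕ → R⟦X⟧} (h : ∀ i, d⁄dX R (F i) = F i * q i) (N : ℕ) :
    d⁄dX R (∏ i ∈ range N, F i) = (∏ i ∈ range N, F i) * ∑ i ∈ range N, q i := by
  induction N with
  | zero => simp
  | succ N ih =>
    rw [prod_range_succ, Derivation.leibniz, ih, h, sum_range_succ]
    simp only [smul_eq_mul]
    ring

lemma succ_mul_coeff_prod {F : ℕ → R⟦X⟧} {q : ℕ → ℕ → R}
    (h : ∀ i, d⁄dX R (F i) = F i * PowerSeries.mk (q i)) (N a : ℕ) :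
    PowerSeries.coeff (a + 1) (∏ i ∈ range N, F i) * (a + 1) =
      ∑ p ∈ antidiagonal a, PowerSeries.coeff p.1 (∏ i ∈ range N, F i) *
        ∑ i ∈ range N, q i p.2 := by
  have := congrArg (PowerSeries.coeff a) (derivative_prod_eq h N)
  rw [PowerSeries.coeff_derivative, PowerSeries.coeff_mul] at this
  simpa using this

lemma mk_pow_mul_one_sub (x : R) :
    PowerSeries.mk (fun n ↦ x ^ n) * (1 - PowerSeries.C x * X) = 1 := by
  ext n
  cases n with
  | zero => simp
  | succ n => simp [mul_sub, ← mul_assoc, PowerSeries.coeff_succ_mul_X, pow_succ,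
      PowerSeries.coeff_one]

lemma derivative_one_add_C_mul_X (x : R) :
    d⁄dX R (1 + PowerSeries.C x * X) =
      (1 + PowerSeries.C x * X) * PowerSeries.mk fun j ↦ (-1) ^ j * x ^ (j + 1) := by
  ext n
  cases n with
  | zero => simp [add_mul, mul_assoc]
  | succ n =>
    simp [add_mul, mul_assoc, PowerSeries.coeff_succ_X_mul]
    ring

lemma derivative_mk_pow (x : R) :
    d⁄dX R (PowerSeries.mk fun n ↦ x ^ n) =
      (PowerSeries.mk fun n ↦ x ^ n) * PowerSeries.mk fun j ↦ x ^ (j + 1) := by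
  have h := mk_pow_mul_one_sub x
  have hx : (PowerSeries.mk fun j ↦ x ^ (j + 1)) =
      PowerSeries.C x * PowerSeries.mk fun n ↦ x ^ n := by
    ext n
    simp [pow_succ']
  have hd := congrArg (d⁄dX R) h
  rw [Derivation.leibniz] at hd
  simp only [smul_eq_mul, map_sub, Derivation.map_one_eq_zero, Derivation.leibniz,
    PowerSeries.derivative_X, PowerSeries.derivative_C] at hd
  rw [hx]
  generalize PowerSeries.mk (fun n ↦ x ^ n) = G at *
  linear_combination (-d⁄dX R G) * h + G * hd

/-- The sum of `x (k 0) ⋯ x (k (a - 1))` over tuples `k` with entries below `N` and consecutive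
gaps at least `c`. -/
def tupleSum (c : ℕ) (x : ℕ → R) (N a : ℕ) : R :=
  ∑ k ∈ (Fintype.piFinset fun _ : Fin a ↦ range N) with ∀ i j, i < j → k i + c ≤ k j,
    ∏ i, x (k i)

lemma tupleSum_zero_right (c : ℕ) (x : ℕ → R) (N : ℕ) : tupleSum c x N 0 = 1 := by
  simp [tupleSum, Finset.filter_true_of_mem]

lemma tupleSum_zero_left (c : ℕ) (x : ℕ → R) (a : ℕ) : tupleSum c x 0 (a + 1) = 0 := by
  refine Finset.sum_eq_zero fun k hk ↦ ?_
  simp at hk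

lemma tupleSum_succ {c : ℕ} (hc : c ≤ 1) (x : ℕ → R) (N a : ℕ) :
    tupleSum c x (N + 1) (a + 1) =
      tupleSum c x N (a + 1) + x N * tupleSum c x (N + 1 - c) a := by
  unfold tupleSum
  rw [← sum_filter_add_sum_filter_not _ fun k : Fin (a + 1) → ℕ ↦ k (Fin.last a) ≠ N]
  congr 1
  · refine sum_congr ?_ fun _ _ ↦ rfl
    ext k
    simp only [mem_filter, Fintype.mem_piFinset, mem_range]
    constructor
    · rintro ⟨⟨h1, h2⟩, h3⟩
      refine ⟨fun i ↦ ?_, h2⟩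
      have h4 := h1 (Fin.last a)
      rcases (Fin.le_last i).eq_or_lt with rfl | hi
      · omega
      · have := h2 _ _ hi
        omega
    · rintro ⟨h1, h2⟩
      exact ⟨⟨fun i ↦ (h1 i).trans (Nat.lt_succ_self N), h2⟩, (h1 _).ne⟩
  · rw [mul_sum]
    refine sum_nbij' Fin.init (fun k ↦ Fin.snoc k N) ?_ ?_ ?_ ?_ ?_
    · intro k
      simp only [mem_filter, Fintype.mem_piFinset, mem_range, not_not]
      rintro ⟨⟨h1, h2⟩, h3⟩
      refine ⟨fun i ↦ ?_, fun i j hij ↦ h2 _ _ (Fin.castSucc_lt_castSucc_iff.mpr hij)⟩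
      have := h2 _ _ (Fin.castSucc_lt_last i)
      simp only [Fin.init]
      omega
    · intro k
      simp only [mem_filter, Fintype.mem_piFinset, mem_range, not_not]
      rintro ⟨h1, h2⟩
      refine ⟨⟨fun i ↦ ?_, fun i j hij ↦ ?_⟩, Fin.snoc_last _ _⟩
      · induction i using Fin.lastCases with
        | last => simp
        | cast i => have := h1 i; simp only [Fin.snoc_castSucc]; omega
      · induction j using Fin.lastCases with
        | last =>
          induction i using Fin.lastCases with
          | last => exact absurd hij (lt_irrefl _)
          | cast i => have := h1 i; simp only [Fin.snoc_castSucc, Fin.snoc_last]; omega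
        | cast j =>
          induction i using Fin.lastCases with
          | last => exact absurd hij (not_lt.mpr (Fin.le_last _))
          | cast i => simpa using h2 i j (Fin.castSucc_lt_castSucc_iff.mp hij)
    · intro k hk
      simp only [mem_filter, not_not] at hk
      rw [← hk.2, Fin.snoc_init_self]
    · intro k _
      exact Fin.init_snoc _ _
    · intro k hk
      simp only [mem_filter, not_not] at hk
      rw [Fin.prod_univ_castSucc, hk.2, mul_comm]
      rfl

lemma tupleSum_one_eq_coeff (x : ℕ → R) (N a : ℕ) :
    tupleSum 1 x N a = PowerSeries.coeff a (∏ i ∈ range N, (1 + PowerSeries.C (x i) * X)) := by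
  induction N generalizing a with
  | zero =>
    cases a with
    | zero => simp [tupleSum_zero_right]
    | succ a => simp [tupleSum_zero_left, PowerSeries.coeff_one]
  | succ N ih =>
    cases a with
    | zero => simp [tupleSum_zero_right, PowerSeries.coeff_zero_eq_constantCoeff]
    | succ a =>
      rw [tupleSum_succ le_rfl, Nat.add_sub_cancel, ih, ih, prod_range_succ, mul_add, mul_one,
        map_add, ← mul_assoc, PowerSeries.coeff_succ_mul_X, PowerSeries.coeff_mul_C, mul_comm (x N)]

lemma tupleSum_zero_eq_coeff (x : ℕ → R) (N a : ℕ) :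
    tupleSum 0 x N a =
      PowerSeries.coeff a (∏ i ∈ range N, PowerSeries.mk fun n ↦ x i ^ n) := by
  induction N generalizing a with
  | zero =>
    cases a with
    | zero => simp [tupleSum_zero_right]
    | succ a => simp [tupleSum_zero_left, PowerSeries.coeff_one]
  | succ N ih =>
    induction a with
    | zero => simp [tupleSum_zero_right, PowerSeries.coeff_zero_eq_constantCoeff]
    | succ a iha =>
      rw [tupleSum_succ zero_le_one, Nat.sub_zero, iha, ih]
      set H := ∏ i ∈ range (N + 1), PowerSeries.mk fun n ↦ x i ^ n with hH
      have : ∏ i ∈ range N, (PowerSeries.mk fun n ↦ x i ^ n) =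
          H - PowerSeries.C (x N) * (H * X) := by
        rw [hH, prod_range_succ]
        linear_combination (-∏ i ∈ range N, (PowerSeries.mk fun n ↦ x i ^ n)) *
          mk_pow_mul_one_sub (x N)
      rw [this, map_sub, PowerSeries.coeff_C_mul, PowerSeries.coeff_succ_mul_X, sub_add_cancel]

end TupleSums

/-- The `k`-th factor `q^(k+1) / (1 - q^(k+1))^2` truncated to its first `N` terms. -/
noncomputable def macMahonTerm (N k : ℕ) : ℤ⟦X⟧ :=
  ∑ s ∈ range N, (PowerSeries.C (s + 1 : ℤ)) * X ^ ((s + 1) * (k + 1))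

lemma coeff_tupleSum_macMahonTerm (c a : ℕ) {n N : ℕ} (hn : n ≤ N) :
    PowerSeries.coeff n (tupleSum c (macMahonTerm N) N a) =
      ∑ f : Fin a → Fin (n + 1) × Fin (n + 1) with
        (∀ i, 0 < ((f i).1 : ℕ) ∧ 0 < ((f i).2 : ℕ)) ∧
        (∀ i j : Fin a, i < j → ((f i).1 : ℕ) + c ≤ (f j).1) ∧
        (∑ i, ((f i).2 : ℕ) * ((f i).1 : ℕ)) = n, ∏ i, ((f i).2 : ℤ) := by
  have h1 : ∀ k : Fin a → ℕ, PowerSeries.coeff n (∏ i, macMahonTerm N (k i)) =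
      ∑ s ∈ Fintype.piFinset fun _ : Fin a ↦ range N,
        if ∑ i, (s i + 1) * (k i + 1) = n then ∏ i, (s i + 1 : ℤ) else 0 := by
    intro k
    simp only [macMahonTerm, Finset.prod_univ_sum, map_sum, prod_mul_distrib, ← map_prod,
      PowerSeries.coeff_C_mul, Finset.prod_pow_eq_pow_sum, PowerSeries.coeff_X_pow, mul_ite,
      mul_one, mul_zero, eq_comm (a := n)]
  rw [tupleSum, map_sum, sum_congr rfl fun k _ ↦ h1 k, ← sum_product', ← sum_filter]
  symm
  refine sum_nbij' (fun f ↦ (fun i ↦ (f i).1 - 1, fun i ↦ (f i).2 - 1))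
    (fun p i ↦ (Fin.ofNat (n + 1) (p.1 i + 1), Fin.ofNat (n + 1) (p.2 i + 1))) ?_ ?_ ?_ ?_ ?_
  · intro f
    simp only [mem_filter, mem_univ, true_and, mem_product, Fintype.mem_piFinset, mem_range]
    rintro ⟨h1, h2, h3⟩
    have h4 : ∀ i, (f i).1.val - 1 + 1 = (f i).1 ∧ (f i).2.val - 1 + 1 = (f i).2 := by
      intro i; have := h1 i; omega
    refine ⟨⟨⟨fun i ↦ ?_, fun i j hij ↦ ?_⟩, fun i ↦ ?_⟩, ?_⟩
    · have := h1 i; have := (f i).1.isLt; omega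
    · have := h1 i; have := h2 i j hij; omega
    · have := h1 i; have := (f i).2.isLt; omega
    · simpa only [h4] using h3
  · intro p
    simp only [mem_filter, mem_univ, true_and, mem_product, Fintype.mem_piFinset, mem_range]
    rintro ⟨⟨⟨h1, h2⟩, h3⟩, h4⟩
    have h5 : ∀ i, p.1 i + 1 < n + 1 ∧ p.2 i + 1 < n + 1 := by
      intro i
      have := single_le_sum (f := fun i ↦ (p.2 i + 1) * (p.1 i + 1)) (fun _ _ ↦ Nat.zero_le _)
        (mem_univ i)
      simp only [h4] at this
      constructor <;> nlinarith
    simp only [Fin.val_ofNat, Nat.mod_eq_of_lt (h5 _).1, Nat.mod_eq_of_lt (h5 _).2]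
    refine ⟨fun i ↦ ⟨Nat.succ_pos _, Nat.succ_pos _⟩, fun i j hij ↦ ?_, h4⟩
    have := h2 i j hij
    omega
  · intro f
    simp only [mem_filter, mem_univ, true_and]
    rintro ⟨h1, -⟩
    ext i
    · simp [Nat.sub_add_cancel (h1 i).1]
    · simp [Nat.sub_add_cancel (h1 i).2]
  · intro p
    simp only [mem_filter, mem_product, Fintype.mem_piFinset, mem_range]
    rintro ⟨⟨⟨h1, h2⟩, h3⟩, h4⟩
    have h5 : ∀ i, p.1 i + 1 < n + 1 ∧ p.2 i + 1 < n + 1 := by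
      intro i
      have := single_le_sum (f := fun i ↦ (p.2 i + 1) * (p.1 i + 1)) (fun _ _ ↦ Nat.zero_le _)
        (mem_univ i)
      simp only [h4] at this
      constructor <;> nlinarith
    ext i
    · simp [Nat.mod_eq_of_lt (h5 i).1]
    · simp [Nat.mod_eq_of_lt (h5 i).2]
  · intro f
    simp only [mem_filter, mem_univ, true_and]
    rintro ⟨h1, -⟩
    refine prod_congr rfl fun i _ ↦ ?_
    have := h1 i
    push_cast [Nat.cast_sub this.2]
    ring

lemma coeff_tupleSum_one_macMahonTerm (a : ℕ) {n N : ℕ} (hn : n ≤ N) :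
    PowerSeries.coeff n (tupleSum 1 (macMahonTerm N) N a) = MO a n := by
  rw [coeff_tupleSum_macMahonTerm 1 a hn, MO]
  push_cast
  rfl

lemma coeff_tupleSum_zero_macMahonTerm (a : ℕ) {n N : ℕ} (hn : n ≤ N) :
    PowerSeries.coeff n (tupleSum 0 (macMahonTerm N) N a) = M a n := by
  rw [coeff_tupleSum_macMahonTerm 0 a hn, M]
  push_cast
  refine sum_congr (filter_congr fun f _ ↦ ?_) fun _ _ ↦ rfl
  refine and_congr_right fun _ ↦ and_congr_left fun _ ↦ ⟨fun h i j hij ↦ ?_, fun h i j hij ↦ ?_⟩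
  · rcases hij.eq_or_lt with rfl | hij
    · exact le_rfl
    · exact h i j hij
  · exact h i j hij.le

/-- The coefficients of `(q / (1 - q)^2)^j`. -/
noncomputable def linearPow (j : ℕ) : ℤ⟦X⟧ := (PowerSeries.mk fun d ↦ (d : ℤ)) ^ j

/-- The power sum `∑_{k ≥ 1} (q^k / (1 - q^k)^2)^j`. -/
noncomputable def powerSumSeries (j : ℕ) : ℤ⟦X⟧ :=
  PowerSeries.mk fun n ↦ ∑ d ∈ n.divisors, PowerSeries.coeff d (linearPow j)

lemma coeff_macMahonTerm {m N : ℕ} (hm : m ≤ N) (k : ℕ) :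
    PowerSeries.coeff m (macMahonTerm N k) =
      PowerSeries.coeff m (PowerSeries.expand (k + 1) k.succ_ne_zero
        (PowerSeries.mk fun d ↦ (d : ℤ))) := by
  simp only [macMahonTerm, map_sum, PowerSeries.coeff_C_mul, PowerSeries.coeff_X_pow,
    PowerSeries.coeff_expand, PowerSeries.coeff_mk, mul_ite, mul_one, mul_zero]
  split_ifs with h
  · obtain ⟨s, rfl⟩ := h
    rw [Nat.mul_div_cancel_left _ k.succ_pos]
    rcases s with _ | s
    · refine Finset.sum_eq_zero fun s _ ↦ if_neg ?_
      positivity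
    · rw [sum_eq_single s]
      · rw [if_pos (mul_comm _ _)]
        simp
      · intro t _ ht
        refine if_neg fun h ↦ ht ?_
        rw [mul_comm] at h
        exact (Nat.succ_injective (Nat.eq_of_mul_eq_mul_right k.succ_pos h)).symm
      · intro hs
        rw [mem_range] at hs
        nlinarith
  · refine Finset.sum_eq_zero fun s _ ↦ if_neg ?_
    rintro rfl
    exact h (dvd_mul_left _ _)

lemma coeff_pow_congr {R : Type*} [CommRing R] {A B : R⟦X⟧} {N : ℕ}
    (h : ∀ m ≤ N, PowerSeries.coeff m A = PowerSeries.coeff m B) (j : ℕ) {m : ℕ} (hm : m ≤ N) :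
    PowerSeries.coeff m (A ^ j) = PowerSeries.coeff m (B ^ j) := by
  rw [← sub_eq_zero, ← map_sub]
  refine PowerSeries.X_pow_dvd_iff.mp
    (dvd_trans (PowerSeries.X_pow_dvd_iff (n := N + 1).mpr fun i hi ↦ ?_) (sub_dvd_pow_sub_pow A B j)) m
    (by omega)
  rw [map_sub, h i (by omega), sub_self]

lemma coeff_sum_macMahonTerm_pow {m N : ℕ} (hm : m ≤ N) (j : ℕ) :
    PowerSeries.coeff m (∑ k ∈ range N, macMahonTerm N k ^ (j + 1)) =
      PowerSeries.coeff m (powerSumSeries (j + 1)) := by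
  have h1 : ∀ k, PowerSeries.coeff m (macMahonTerm N k ^ (j + 1)) =
      if k + 1 ∣ m then PowerSeries.coeff (m / (k + 1)) (linearPow (j + 1)) else 0 := by
    intro k
    rw [coeff_pow_congr (fun i hi ↦ coeff_macMahonTerm hi k) _ hm, ← map_pow,
      PowerSeries.coeff_expand]
    rfl
  rw [map_sum, powerSumSeries, PowerSeries.coeff_mk, sum_congr rfl fun k _ ↦ h1 k,
    ← Nat.sum_div_divisors m fun d ↦ PowerSeries.coeff d (linearPow (j + 1)), ← sum_filter]
  rcases m.eq_zero_or_pos with rfl | hm0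
  · simp [linearPow]
  refine sum_nbij' (· + 1) (· - 1) ?_ ?_ ?_ ?_ ?_
  · intro k hk
    simp only [mem_filter] at hk
    exact Nat.mem_divisors.mpr ⟨hk.2, hm0.ne'⟩
  · intro d hd
    have h2 := Nat.pos_of_mem_divisors hd
    have h3 := Nat.divisor_le hd
    simp only [mem_filter, mem_range, Nat.sub_add_cancel h2]
    exact ⟨by omega, Nat.dvd_of_mem_divisors hd⟩
  · intro k _
    rfl
  · intro d hd
    exact Nat.sub_add_cancel (Nat.pos_of_mem_divisors hd)
  · intro k _
    rfl

lemma coeff_mul_congr {R : Type*} [CommRing R] {A B C D : R⟦X⟧} {N : ℕ}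
    (h : ∀ m ≤ N, PowerSeries.coeff m A = PowerSeries.coeff m B)
    (h' : ∀ m ≤ N, PowerSeries.coeff m C = PowerSeries.coeff m D) :
    PowerSeries.coeff N (A * C) = PowerSeries.coeff N (B * D) := by
  rw [PowerSeries.coeff_mul, PowerSeries.coeff_mul]
  refine sum_congr rfl fun p hp ↦ ?_
  have := mem_antidiagonal.mp hp
  rw [h _ (by omega), h' _ (by omega)]

theorem succ_nsmul_MO_series (a : ℕ) :
    (a + 1) • (PowerSeries.mk fun n ↦ (MO (a + 1) n : ℤ)) =
      ∑ p ∈ antidiagonal a, (PowerSeries.mk fun n ↦ (MO p.1 n : ℤ)) *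
        ((-1 : ℤ) ^ p.2 • powerSumSeries (p.2 + 1)) := by
  ext n
  have h := congrArg (PowerSeries.coeff n) (succ_mul_coeff_prod
    (fun i ↦ derivative_one_add_C_mul_X (macMahonTerm n i)) n a)
  simp only [← tupleSum_one_eq_coeff, ← mul_sum] at h
  rw [map_nsmul, PowerSeries.coeff_mk, ← coeff_tupleSum_one_macMahonTerm _ le_rfl, ← map_nsmul,
    nsmul_eq_mul, mul_comm, Nat.cast_succ, h, map_sum, map_sum]
  refine sum_congr rfl fun p _ ↦ coeff_mul_congr (fun m hm ↦ ?_) fun m hm ↦ ?_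
  · rw [PowerSeries.coeff_mk, coeff_tupleSum_one_macMahonTerm _ hm]
  · rw [map_zsmul, ← coeff_sum_macMahonTerm_pow hm, ← map_zsmul, zsmul_eq_mul]
    push_cast
    rfl

theorem succ_nsmul_M_series (a : ℕ) :
    (a + 1) • (PowerSeries.mk fun n ↦ (M (a + 1) n : ℤ)) =
      ∑ p ∈ antidiagonal a, (PowerSeries.mk fun n ↦ (M p.1 n : ℤ)) *
        powerSumSeries (p.2 + 1) := by
  ext n
  have h := congrArg (PowerSeries.coeff n) (succ_mul_coeff_prod
    (fun i ↦ derivative_mk_pow (macMahonTerm n i)) n a)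
  simp only [← tupleSum_zero_eq_coeff] at h
  rw [map_nsmul, PowerSeries.coeff_mk, ← coeff_tupleSum_zero_macMahonTerm _ le_rfl, ← map_nsmul,
    nsmul_eq_mul, mul_comm, Nat.cast_succ, h, map_sum, map_sum]
  refine sum_congr rfl fun p _ ↦ coeff_mul_congr (fun m hm ↦ ?_) fun m hm ↦ ?_
  · rw [PowerSeries.coeff_mk, coeff_tupleSum_zero_macMahonTerm _ hm]
  · exact coeff_sum_macMahonTerm_pow hm _

lemma MO_series_zero : (PowerSeries.mk fun n ↦ (MO 0 n : ℤ)) = 1 := by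
  ext n
  rw [PowerSeries.coeff_mk, ← coeff_tupleSum_one_macMahonTerm _ le_rfl, tupleSum_zero_right]

lemma M_series_zero : (PowerSeries.mk fun n ↦ (M 0 n : ℤ)) = 1 := by
  ext n
  rw [PowerSeries.coeff_mk, ← coeff_tupleSum_zero_macMahonTerm _ le_rfl, tupleSum_zero_right]

lemma coeff_X_mul_derivative {R : Type*} [CommRing R] (A : R⟦X⟧) (d : ℕ) :
    PowerSeries.coeff d (X * d⁄dX R A) = d * PowerSeries.coeff d A := by
  cases d with
  | zero => simp
  | succ d => rw [PowerSeries.coeff_succ_X_mul, PowerSeries.coeff_derivative]; push_cast; ring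

lemma linearPow_recurrence (j : ℕ) :
    X * d⁄dX ℤ (X * d⁄dX ℤ (linearPow (j + 1))) =
      ((j + 1) ^ 2 : ℤ) • linearPow (j + 1) +
        (2 * (j + 1) * (2 * (j + 1) + 1) : ℤ) • linearPow (j + 2) := by
  have hu : (PowerSeries.mk (1 : ℕ → ℤ)) * (1 - X) = 1 := PowerSeries.mk_one_mul_one_sub_eq_one ℤ
  have hdu : d⁄dX ℤ (PowerSeries.mk (1 : ℕ → ℤ)) = PowerSeries.mk (1 : ℕ → ℤ) ^ 2 := by
    have := derivative_mk_pow (1 : ℤ)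
    simp only [one_pow] at this
    rw [sq]
    exact this
  have hx : (PowerSeries.mk fun d ↦ (d : ℤ)) = X * PowerSeries.mk (1 : ℕ → ℤ) ^ 2 := by
    rw [← hdu]
    ext d
    simp [coeff_X_mul_derivative]
  simp only [linearPow, hx]
  generalize PowerSeries.mk (1 : ℕ → ℤ) = u at hu hdu
  have hdx : X * d⁄dX ℤ (X * u ^ 2) = X * u ^ 2 * (1 + 2 * X * u) := by
    simp only [Derivation.leibniz, Derivation.leibniz_pow, hdu, smul_eq_mul, nsmul_eq_mul,
      PowerSeries.derivative_X]
    push_cast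
    ring
  have hdv : X * d⁄dX ℤ (1 + 2 * X * u) = 2 * (X * u ^ 2) := by
    have h2 : d⁄dX ℤ (2 : ℤ⟦X⟧) = 0 := (d⁄dX ℤ).map_natCast 2
    simp only [map_add, Derivation.leibniz, hdu, smul_eq_mul, PowerSeries.derivative_X,
      Derivation.map_one_eq_zero, h2]
    linear_combination (-2 * X * u) * hu
  have hv : (1 + 2 * X * u) ^ 2 = 1 + 4 * (X * u ^ 2) := by
    linear_combination (-4 * X * u) * hu
  generalize 1 + 2 * X * u = v at hdx hdv hv
  generalize X * u ^ 2 = x at hdx hdv hv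
  have h1 : X * d⁄dX ℤ (x ^ (j + 1)) = ((j + 1 : ℕ) : ℤ⟦X⟧) * (x ^ (j + 1) * v) := by
    rw [Derivation.leibniz_pow, Nat.add_sub_cancel, nsmul_eq_mul, smul_eq_mul]
    linear_combination (((j + 1 : ℕ) : ℤ⟦X⟧) * x ^ j) * hdx
  rw [h1]
  simp only [Derivation.leibniz, Derivation.map_natCast, smul_eq_mul, zsmul_eq_mul]
  push_cast at h1 ⊢
  linear_combination ((j + 1 : ℤ⟦X⟧) * x ^ (j + 1)) * hdv + ((j + 1 : ℤ⟦X⟧) * v) * h1 +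
    ((j + 1 : ℤ⟦X⟧) ^ 2 * x ^ (j + 1)) * hv

/-- The generating series of `∑_{d ∣ n} d^(2i) c_j(d)`, where `c_j(d)` are the coefficients of
`linearPow j`. -/
noncomputable def twistedPowerSum (i j : ℕ) : ℤ⟦X⟧ :=
  PowerSeries.mk fun n ↦ ∑ d ∈ n.divisors, (d : ℤ) ^ (2 * i) * PowerSeries.coeff d (linearPow j)

/-- The generating series of the divisor sums `σ_k(n)`. -/
noncomputable def sigmaSeries (k : ℕ) : ℤ⟦X⟧ :=
  PowerSeries.mk fun n ↦ (ArithmeticFunction.sigma k n : ℤ)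

lemma twistedPowerSum_one (i : ℕ) : twistedPowerSum i 1 = sigmaSeries (2 * i + 1) := by
  ext n
  simp [twistedPowerSum, sigmaSeries, linearPow, ArithmeticFunction.sigma_apply, pow_succ]

lemma twistedPowerSum_recurrence (i j : ℕ) :
    (2 * (j + 1) * (2 * (j + 1) + 1) : ℤ) • twistedPowerSum i (j + 2) =
      twistedPowerSum (i + 1) (j + 1) - ((j + 1) ^ 2 : ℤ) • twistedPowerSum i (j + 1) := by
  ext n
  simp only [twistedPowerSum, map_zsmul, map_sub, PowerSeries.coeff_mk, smul_eq_mul, mul_sum,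
    ← sum_sub_distrib]
  refine sum_congr rfl fun d _ ↦ ?_
  have h := congrArg (PowerSeries.coeff d) (linearPow_recurrence j)
  simp only [coeff_X_mul_derivative, map_add, map_zsmul, smul_eq_mul] at h
  linear_combination (-(d : ℤ) ^ (2 * i)) * h

lemma twistedPowerSum_mem {Q : Subalgebra ℤ ℤ⟦X⟧}
    (hQ : ∀ c : ℤ, c ≠ 0 → ∀ A, c • A ∈ Q → A ∈ Q) (hσ : ∀ i, sigmaSeries (2 * i + 1) ∈ Q)
    (i j : ℕ) : twistedPowerSum i (j + 1) ∈ Q := by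
  induction j generalizing i with
  | zero => exact twistedPowerSum_one i ▸ hσ i
  | succ j ih =>
    refine hQ (2 * (j + 1) * (2 * (j + 1) + 1)) (by positivity) _ ?_
    rw [twistedPowerSum_recurrence]
    exact Q.sub_mem (ih _) (Q.zsmul_mem (ih _) _)

lemma powerSumSeries_mem {Q : Subalgebra ℤ ℤ⟦X⟧}
    (hQ : ∀ c : ℤ, c ≠ 0 → ∀ A, c • A ∈ Q → A ∈ Q) (hσ : ∀ i, sigmaSeries (2 * i + 1) ∈ Q)
    (j : ℕ) : powerSumSeries (j + 1) ∈ Q := by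
  simpa [twistedPowerSum, powerSumSeries] using twistedPowerSum_mem hQ hσ 0 j

theorem MO_series_mem {Q : Subalgebra ℤ ℤ⟦X⟧}
    (hQ : ∀ c : ℤ, c ≠ 0 → ∀ A, c • A ∈ Q → A ∈ Q) (hσ : ∀ i, sigmaSeries (2 * i + 1) ∈ Q)
    (a : ℕ) : (PowerSeries.mk fun n ↦ (MO a n : ℤ)) ∈ Q := by
  induction a using Nat.strong_induction_on with
  | _ a ih =>
    cases a with
    | zero => exact MO_series_zero ▸ Q.one_mem
    | succ a =>
      refine hQ (a + 1 : ℕ) (by positivity) _ ?_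
      rw [natCast_zsmul, succ_nsmul_MO_series]
      refine Q.sum_mem fun p hp ↦ Q.mul_mem (ih _ ?_) (Q.zsmul_mem (powerSumSeries_mem hQ hσ _) _)
      have := mem_antidiagonal.mp hp
      omega

theorem M_series_mem {Q : Subalgebra ℤ ℤ⟦X⟧}
    (hQ : ∀ c : ℤ, c ≠ 0 → ∀ A, c • A ∈ Q → A ∈ Q) (hσ : ∀ i, sigmaSeries (2 * i + 1) ∈ Q)
    (a : ℕ) : (PowerSeries.mk fun n ↦ (M a n : ℤ)) ∈ Q := by
  induction a using Nat.strong_induction_on with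
  | _ a ih =>
    cases a with
    | zero => exact M_series_zero ▸ Q.one_mem
    | succ a =>
      refine hQ (a + 1 : ℕ) (by positivity) _ ?_
      rw [natCast_zsmul, succ_nsmul_M_series]
      refine Q.sum_mem fun p hp ↦ Q.mul_mem (ih _ ?_) (powerSumSeries_mem hQ hσ _)
      have := mem_antidiagonal.mp hp
      omega

/-- `f` is given on the upper half plane by the series `∑ c n * q ^ n`, where `q = exp (2πiz)`. -/
def HasQSeries (f : ℍ → ℂ) (c : ℕ → ℂ) : Prop :=
  ∀ z : ℍ, HasSum (fun n ↦ c n * Function.Periodic.qParam 1 z ^ n) (f z)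

namespace HasQSeries

variable {f g : ℍ → ℂ} {c d : ℕ → ℂ}

lemma zero : HasQSeries 0 0 := fun _ ↦ by simp

lemma add (hf : HasQSeries f c) (hg : HasQSeries g d) : HasQSeries (f + g) (c + d) := fun z ↦ by
  simpa only [Pi.add_apply, add_mul] using (hf z).add (hg z)

lemma const_mul (hf : HasQSeries f c) (a : ℂ) : HasQSeries (a • f) (a • c) := fun z ↦ by
  simpa only [Pi.smul_apply, smul_eq_mul, mul_assoc] using (hf z).mul_left a

lemma sum {ι : Type*} {s : Finset ι} {f : ι → ℍ → ℂ} {c : ι → ℕ → ℂ}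
    (h : ∀ i ∈ s, HasQSeries (f i) (c i)) : HasQSeries (∑ i ∈ s, f i) (∑ i ∈ s, c i) := by
  classical
  induction s using Finset.induction_on with
  | empty => simpa using zero
  | insert i s hi ih =>
    rw [sum_insert hi, sum_insert hi]
    exact (h i (mem_insert_self i s)).add (ih fun j hj ↦ h j (mem_insert_of_mem hj))

lemma mul (hf : HasQSeries f c) (hg : HasQSeries g d) :
    HasQSeries (f * g) fun n ↦ ∑ p ∈ antidiagonal n, c p.1 * d p.2 := fun z ↦ by
  have h := (summable_norm_sum_mul_antidiagonal_of_summable_norm (hf z).summable.norm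
    (hg z).summable.norm).of_norm.hasSum
  rw [← tsum_mul_tsum_eq_tsum_sum_antidiagonal_of_summable_norm (hf z).summable.norm
    (hg z).summable.norm, (hf z).tsum_eq, (hg z).tsum_eq] at h
  refine Eq.subst (motive := fun F ↦ HasSum F _) (funext fun n ↦ ?_) h
  rw [sum_mul]
  refine sum_congr rfl fun p hp ↦ ?_
  rw [← mem_antidiagonal.mp hp, pow_add]
  ring

lemma eq_zero (h : HasQSeries 0 c) : c = 0 := by
  ext m
  rw [ModularFormClass.qExpansion_coeff_unique (f := (0 : ModularForm 𝒮ℒ 0)) one_pos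
    one_mem_strictPeriods_SL h m, FunLike.coe_zero,
    UpperHalfPlane.qExpansion_zero]
  simp

lemma unique (h : HasQSeries f c) (h' : HasQSeries f d) : c = d := by
  have := h.add (h'.const_mul (-1))
  simp only [neg_smul, one_smul, add_neg_cancel] at this
  exact add_neg_eq_zero.mp this.eq_zero

end HasQSeries

/-- The functions of weight `k` in the algebra generated by `E₂` and the modular forms of
level one. -/
noncomputable def quasimodular (k : ℕ) : Submodule ℂ (ℍ → ℂ) :=
  Submodule.span ℂ {f | ∃ (j w : ℕ) (g : ModularForm 𝒮ℒ w), w + 2 * j = k ∧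
    f = EisensteinSeries.E2 ^ j * g}

lemma E2_pow_mul_mem_quasimodular (j : ℕ) {w : ℕ} (g : ModularForm 𝒮ℒ w) :
    EisensteinSeries.E2 ^ j * (g : ℍ → ℂ) ∈ quasimodular (w + 2 * j) :=
  Submodule.subset_span ⟨j, w, g, rfl, rfl⟩

lemma coe_mem_quasimodular {w : ℕ} (g : ModularForm 𝒮ℒ w) : (g : ℍ → ℂ) ∈ quasimodular w := by
  simpa using E2_pow_mul_mem_quasimodular 0 g

/-- The inclusion of level one modular forms in the space of all functions. -/
noncomputable def coeModularForm (w : ℕ) : ModularForm 𝒮ℒ w →ₗ[ℂ] (ℍ → ℂ) where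
  toFun g := g
  map_add' _ _ := rfl
  map_smul' _ _ := rfl

instance (k : ℕ) : FiniteDimensional ℂ (quasimodular k) := by
  let N (p : ℕ × ℕ) : Submodule ℂ (ℍ → ℂ) := LinearMap.range
    ((LinearMap.mulLeft ℂ (EisensteinSeries.E2 ^ p.1)).comp (coeModularForm p.2))
  have h : quasimodular k ≤ (range (k + 1) ×ˢ range (k + 1)).sup N := by
    refine Submodule.span_le.mpr ?_
    rintro _ ⟨j, w, g, h, rfl⟩
    refine le_sup (f := N) (b := (j, w)) ?_ ⟨g, rfl⟩
    simp only [mem_product, mem_range]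
    omega
  have (p : ℕ × ℕ) : FiniteDimensional ℂ (N p) := by
    unfold N
    infer_instance
  have := Submodule.finiteDimensional_finset_sup (range (k + 1) ×ˢ range (k + 1)) N
  exact Submodule.finiteDimensional_of_le h

lemma mul_mem_quasimodular {k l : ℕ} {f g : ℍ → ℂ} (hf : f ∈ quasimodular k)
    (hg : g ∈ quasimodular l) : f * g ∈ quasimodular (k + l) := by
  induction hf using Submodule.span_induction with
  | zero => simp
  | add _ _ _ _ h₁ h₂ => rw [add_mul]; exact Submodule.add_mem _ h₁ h₂
  | smul a _ _ h => rw [smul_mul_assoc]; exact Submodule.smul_mem _ a h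
  | mem f hf =>
    obtain ⟨j, w, f, rfl, rfl⟩ := hf
    induction hg using Submodule.span_induction with
    | zero => simp
    | add _ _ _ _ h₁ h₂ => rw [mul_add]; exact Submodule.add_mem _ h₁ h₂
    | smul a _ _ h => rw [mul_smul_comm]; exact Submodule.smul_mem _ a h
    | mem g hg =>
      obtain ⟨i, v, g, rfl, rfl⟩ := hg
      refine Submodule.subset_span ⟨j + i, w + v, (f.mul g).mcast (by push_cast; rfl), by ring, ?_⟩
      ext z
      simp [pow_add]
      ring

/-- The integral `q`-series of quasimodular forms of weight `k`. -/
noncomputable def quasimodularLattice (k : ℕ) : Submodule ℤ ℤ⟦X⟧ where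
  carrier := {A | ∃ f ∈ quasimodular k, HasQSeries f fun n ↦ ((PowerSeries.coeff n A : ℤ) : ℂ)}
  zero_mem' := ⟨0, Submodule.zero_mem _, by simpa using! HasQSeries.zero⟩
  add_mem' := by
    rintro A B ⟨f, hf, hA⟩ ⟨g, hg, hB⟩
    exact ⟨f + g, Submodule.add_mem _ hf hg, by simpa using! hA.add hB⟩
  smul_mem' := by
    rintro a A ⟨f, hf, hA⟩
    exact ⟨(a : ℂ) • f, Submodule.smul_mem _ _ hf, by
      have h := hA.const_mul a
      simp only [map_zsmul, smul_eq_mul, Int.cast_mul]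
      exact h⟩

lemma mul_mem_quasimodularLattice {k l : ℕ} {A B : ℤ⟦X⟧} (hA : A ∈ quasimodularLattice k)
    (hB : B ∈ quasimodularLattice l) : A * B ∈ quasimodularLattice (k + l) := by
  obtain ⟨f, hf, hA⟩ := hA
  obtain ⟨g, hg, hB⟩ := hB
  exact ⟨f * g, mul_mem_quasimodular hf hg, by
    simpa [PowerSeries.coeff_mul] using! hA.mul hB⟩

lemma exists_bound_quasimodular (k : ℕ) : ∃ B : ℕ, ∀ f ∈ quasimodular k, ∀ c, HasQSeries f c →
    (∀ n < B, c n = 0) → c = 0 := by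
  let Z : ℕ →o (Submodule ℂ (quasimodular k))ᵒᵈ :=
    { toFun := fun B ↦ OrderDual.toDual
        { carrier := {f | ∃ c, HasQSeries f.1 c ∧ ∀ n < B, c n = 0}
          zero_mem' := ⟨0, HasQSeries.zero, fun _ _ ↦ rfl⟩
          add_mem' := by
            rintro f g ⟨c, hf, hc⟩ ⟨d, hg, hd⟩
            exact ⟨c + d, hf.add hg, fun n hn ↦ by simp [hc n hn, hd n hn]⟩
          smul_mem' := by
            rintro a f ⟨c, hf, hc⟩
            exact ⟨a • c, hf.const_mul a, fun n hn ↦ by simp [hc n hn]⟩ }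
      monotone' := by
        rintro B C hBC f ⟨c, hf, hc⟩
        exact ⟨c, hf, fun n hn ↦ hc n (hn.trans_le hBC)⟩ }
  obtain ⟨B, hB⟩ := IsArtinian.monotone_stabilizes Z
  refine ⟨B, fun f hf c hc h0 ↦ ?_⟩
  ext n
  have h1 : (⟨f, hf⟩ : quasimodular k) ∈ OrderDual.ofDual (Z B) := ⟨c, hc, h0⟩
  rw [hB (max B (n + 1)) (le_max_left _ _)] at h1
  obtain ⟨d, hd, hd0⟩ := h1
  rw [hc.unique hd]
  exact hd0 n (lt_max_of_lt_right n.lt_succ_self)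

lemma quasimodularLattice_fg (k : ℕ) : (quasimodularLattice k).FG := by
  obtain ⟨B, hB⟩ := exists_bound_quasimodular k
  let φ : quasimodularLattice k →ₗ[ℤ] Fin B → ℤ :=
    { toFun := fun A n ↦ PowerSeries.coeff n A.1
      map_add' := fun _ _ ↦ by ext; simp
      map_smul' := fun _ _ ↦ by ext; exact map_zsmul _ _ _ }
  have hφ : Function.Injective φ := by
    rw [← LinearMap.ker_eq_bot, LinearMap.ker_eq_bot']
    rintro ⟨A, f, hf, hA⟩ h
    have h2 := hB f hf _ hA fun n hn ↦ by exact_mod_cast congrFun h ⟨n, hn⟩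
    refine Subtype.ext (PowerSeries.ext fun n ↦ ?_)
    have h3 : ((PowerSeries.coeff n A : ℤ) : ℂ) = 0 := congrFun h2 n
    change PowerSeries.coeff n A = PowerSeries.coeff n 0
    rw [map_zero]
    exact_mod_cast h3
  exact Module.Finite.iff_fg.mp (Module.Finite.of_injective φ hφ)

/-- The point `az + b` of the upper half plane. -/
noncomputable def affinePoint (a : {x : ℝ // 0 < x}) (b : ℝ) (z : ℍ) : ℍ := b +ᵥ a • z

lemma mdifferentiable_affinePoint (a : {x : ℝ // 0 < x}) (b : ℝ) :
    MDiff (affinePoint a b) := by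
  have h (z : ℍ) : affinePoint a b z = UpperHalfPlane.ofComplex (b + a * z : ℂ) := by
    rw [← UpperHalfPlane.ofComplex_apply (affinePoint a b z)]
    simp [affinePoint]
  intro z
  rw [funext h]
  refine (UpperHalfPlane.mdifferentiableAt_ofComplex ?_).comp z
    (((mdifferentiable_const (c := (b : ℂ))).add
      ((mdifferentiable_const (c := (a : ℂ))).mul UpperHalfPlane.mdifferentiable_coe)) z)
  simpa using mul_pos a.2 z.im_pos

lemma isBoundedAtImInfty_comp_affinePoint {f : ℍ → ℂ}
    (hf : UpperHalfPlane.IsBoundedAtImInfty f) (a : {x : ℝ // 0 < x}) (b : ℝ) :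
    UpperHalfPlane.IsBoundedAtImInfty (f ∘ affinePoint a b) := by
  rw [UpperHalfPlane.isBoundedAtImInfty_iff] at hf ⊢
  obtain ⟨M, A, h⟩ := hf
  refine ⟨M, A / a, fun z hz ↦ h _ ?_⟩
  rw [div_le_iff₀' a.2] at hz
  simpa [affinePoint] using hz

section HeckePoint

variable (l : ℕ) [hl : Fact l.Prime]

/-- The images of `z` under representatives of the classes of integral matrices of
determinant `l`. -/
noncomputable def heckePoint : Option (ZMod l) → ℍ → ℍ
  | none => affinePoint ⟨l, mod_cast hl.1.pos⟩ 0
  | some b => affinePoint ⟨(l : ℝ)⁻¹, inv_pos.mpr (mod_cast hl.1.pos)⟩ (b.val / l)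

/-- The automorphy factor attached to `heckePoint`. -/
noncomputable def heckeFactor : Option (ZMod l) → ℂ
  | none => l
  | some _ => 1

lemma coe_heckePoint_none (z : ℍ) : (heckePoint l none z : ℂ) = l * z := by
  simp [heckePoint, affinePoint]

lemma coe_heckePoint_some (b : ZMod l) (z : ℍ) :
    (heckePoint l (some b) z : ℂ) = (z + b.val) / l := by
  simp [heckePoint, affinePoint, -ZMod.natCast_val]
  ring

lemma mdifferentiable_comp_heckePoint {f : ℍ → ℂ} (hf : MDiff f) (i : Option (ZMod l)) :
    MDiff (f ∘ heckePoint l i) := by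
  cases i <;> exact hf.comp (mdifferentiable_affinePoint _ _)

lemma isBoundedAtImInfty_comp_heckePoint {f : ℍ → ℂ}
    (hf : UpperHalfPlane.IsBoundedAtImInfty f) (i : Option (ZMod l)) :
    UpperHalfPlane.IsBoundedAtImInfty (f ∘ heckePoint l i) := by
  cases i <;> exact isBoundedAtImInfty_comp_affinePoint hf _ _

/-- The element `γ₀` permutes the Hecke points of index `l` up to the modular group. -/
def PermutesHeckePoints (γ₀ : SL(2, ℤ)) : Prop :=
  ∃ σ : Equiv.Perm (Option (ZMod l)), ∀ (i : Option (ZMod l)) (z : ℍ), ∃ γ : SL(2, ℤ),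
    heckePoint l i (γ₀ • z) = γ • heckePoint l (σ i) z ∧
    heckeFactor l i * UpperHalfPlane.denom γ (heckePoint l (σ i) z) =
      UpperHalfPlane.denom γ₀ z * heckeFactor l (σ i) ∧
    (γ 1 0 : ℂ) * heckeFactor l i * heckeFactor l (σ i) = l * γ₀ 1 0

lemma permutesHeckePoints_T : PermutesHeckePoints l ModularGroup.T := by
  have hl0 : (l : ℂ) ≠ 0 := mod_cast hl.1.ne_zero
  have key : ∀ (i : Option (ZMod l)) (z : ℍ), ∃ n : ℤ,
      heckePoint l i (ModularGroup.T • z) =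
        ModularGroup.T ^ n • heckePoint l ((Equiv.addRight (1 : ZMod l)).optionCongr i) z := by
    rintro (_ | b) z
    · refine ⟨l, ?_⟩
      ext1
      rw [UpperHalfPlane.modular_T_zpow_smul, UpperHalfPlane.modular_T_smul,
        UpperHalfPlane.coe_vadd, Equiv.optionCongr_apply, Option.map_none, coe_heckePoint_none,
        coe_heckePoint_none, UpperHalfPlane.coe_vadd]
      push_cast
      ring
    · obtain ⟨n, hn⟩ : ∃ n : ℤ, (b.val + 1 : ℤ) = (b + 1).val + l * n := by
        have : ((b.val + 1 : ℤ) : ZMod l) = (((b + 1).val : ℤ) : ZMod l) := by simp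
        rw [ZMod.intCast_eq_intCast_iff_dvd_sub] at this
        obtain ⟨n, hn⟩ := this
        exact ⟨-n, by linarith⟩
      refine ⟨n, ?_⟩
      ext1
      rw [UpperHalfPlane.modular_T_zpow_smul, UpperHalfPlane.modular_T_smul,
        UpperHalfPlane.coe_vadd, Equiv.optionCongr_apply, Option.map_some, coe_heckePoint_some,
        coe_heckePoint_some, UpperHalfPlane.coe_vadd]
      have hn' : (b.val + 1 : ℂ) = (b + 1).val + l * n := by exact_mod_cast hn
      field_simp
      push_cast
      simp only [Equiv.coe_addRight]
      linear_combination hn'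
  refine ⟨(Equiv.addRight (1 : ZMod l)).optionCongr, fun i z ↦ ?_⟩
  obtain ⟨n, hn⟩ := key i z
  refine ⟨ModularGroup.T ^ n, hn, ?_, ?_⟩
  · rw [ModularGroup.denom_apply, ModularGroup.denom_apply, ModularGroup.coe_T_zpow]
    cases i <;> simp [heckeFactor, ModularGroup.T]
  · rw [ModularGroup.coe_T_zpow]
    simp [ModularGroup.T]

lemma permutesHeckePoints_S : PermutesHeckePoints l ModularGroup.S := by
  classical
  have hl0 : (l : ℂ) ≠ 0 := mod_cast hl.1.ne_zero
  let σ : Option (ZMod l) → Option (ZMod l)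
    | none => some 0
    | some b => if b = 0 then none else some (-b⁻¹)
  have hσ : Function.Involutive σ := by
    rintro (_ | b)
    · simp [σ]
    · by_cases hb : b = 0
      · simp [σ, hb]
      · simp [σ, hb]
  refine ⟨hσ.toPerm σ, ?_⟩
  rintro (_ | b) z
  · refine ⟨ModularGroup.S, ?_, ?_, ?_⟩
    · ext1
      rw [UpperHalfPlane.modular_S_smul, UpperHalfPlane.modular_S_smul]
      change _ = (-(heckePoint l (some 0) z : ℂ))⁻¹
      rw [coe_heckePoint_none, coe_heckePoint_some]
      have := z.ne_zero
      change (l : ℂ) * (-(z : ℂ))⁻¹ = _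
      simp
      field_simp
    · change _ * UpperHalfPlane.denom _ (heckePoint l (some 0) z) = _ * heckeFactor l (some 0)
      rw [ModularGroup.denom_apply, ModularGroup.denom_apply, coe_heckePoint_some]
      simp [heckeFactor, ModularGroup.S]
      field_simp
    · change _ * heckeFactor l (some 0) = _
      simp [heckeFactor, ModularGroup.S]
  by_cases hb : b = 0
  · subst hb
    have hs : hσ.toPerm σ (some 0) = none := by simp [σ]
    rw [hs]
    refine ⟨ModularGroup.S, ?_, ?_, ?_⟩
    · ext1
      rw [UpperHalfPlane.modular_S_smul, UpperHalfPlane.modular_S_smul]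
      change _ = (-(heckePoint l none z : ℂ))⁻¹
      rw [coe_heckePoint_none, coe_heckePoint_some]
      have := z.ne_zero
      change ((-(z : ℂ))⁻¹ + _) / l = _
      simp
      field_simp
    · rw [ModularGroup.denom_apply, ModularGroup.denom_apply, coe_heckePoint_none]
      simp [heckeFactor, ModularGroup.S]
      ring
    · simp [heckeFactor, ModularGroup.S]
  · have hs : hσ.toPerm σ (some b) = some (-b⁻¹) := by simp [σ, hb]
    rw [hs]
    obtain ⟨n, hn⟩ : (l : ℤ) ∣ 1 + b.val * (-b⁻¹).val := by
      rw [← ZMod.intCast_zmod_eq_zero_iff_dvd]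
      simp [hb]
    obtain ⟨γ, h00, h01, h10, h11⟩ : ∃ γ : SL(2, ℤ), γ 0 0 = b.val ∧ γ 0 1 = -n ∧ γ 1 0 = l ∧
        γ 1 1 = -(-b⁻¹).val :=
      ⟨⟨!![(b.val : ℤ), -n; l, -(-b⁻¹).val], by rw [Matrix.det_fin_two_of]; linarith⟩,
        rfl, rfl, rfl, rfl⟩
    refine ⟨γ, ?_, ?_, ?_⟩
    · have hn' : (1 + b.val * (-b⁻¹).val : ℂ) = l * n := by exact_mod_cast hn
      ext1
      rw [UpperHalfPlane.coe_specialLinearGroup_apply, UpperHalfPlane.modular_S_smul,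
        coe_heckePoint_some, coe_heckePoint_some, h00, h01, h10, h11]
      have hz := z.ne_zero
      generalize (-b⁻¹).val = c at hn'
      have hd : (l : ℂ) * ((z + c) / l) + -c = z := by field_simp; ring
      change ((-(z : ℂ))⁻¹ + _) / l = _
      simp only [algebraMap_int_eq, eq_intCast]
      push_cast
      rw [hd]
      field_simp
      linear_combination -hn'
    · rw [ModularGroup.denom_apply, ModularGroup.denom_apply, coe_heckePoint_some, h10, h11]
      simp [heckeFactor, ModularGroup.S]
      field_simp
      ring
    · simp [heckeFactor, ModularGroup.S, h10]

end HeckePoint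

section HeckeTransform

variable (l : ℕ) [hl : Fact l.Prime]

/-- The modular form `E₂` transformed by a Hecke matrix, corrected to be modular. -/
noncomputable def heckeE2 (i : Option (ZMod l)) : ℍ → ℂ :=
  heckeFactor l i ^ 2 • (EisensteinSeries.E2 ∘ heckePoint l i) -
    (l : ℂ) • EisensteinSeries.E2

lemma E2_smul (γ : SL(2, ℤ)) (z : ℍ) : EisensteinSeries.E2 (γ • z) =
    UpperHalfPlane.denom γ z ^ 2 * EisensteinSeries.E2 z -
      1 / (2 * riemannZeta 2) * (2 * Real.pi * Complex.I) * γ 1 0 * UpperHalfPlane.denom γ z := by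
  have h := congrFun (EisensteinSeries.E2_slash_action γ) z
  rw [ModularForm.SL_slash_apply, zpow_neg, mul_inv_eq_iff_eq_mul₀
    (zpow_ne_zero _ (UpperHalfPlane.denom_ne_zero _ z))] at h
  rw [h]
  have := UpperHalfPlane.denom_ne_zero γ z
  simp only [Pi.sub_apply, Pi.smul_apply, EisensteinSeries.D2, smul_eq_mul]
  norm_cast
  field_simp

variable {l}

/-- The trace `∑ φᵢ ^ m * g|γᵢ` is invariant under elements permuting the Hecke points. -/
lemma PermutesHeckePoints.slash_eq {γ₀ : SL(2, ℤ)} (h : PermutesHeckePoints l γ₀) (m : ℕ) {w : ℕ}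
    (g : ModularForm 𝒮ℒ w) :
    (∑ i, heckeE2 l i ^ m * heckeFactor l i ^ w • (g ∘ heckePoint l i)) ∣[((w + 2 * m : ℕ) : ℤ)] γ₀ =
      ∑ i, heckeE2 l i ^ m * heckeFactor l i ^ w • (g ∘ heckePoint l i) := by
  obtain ⟨σ, hσ⟩ := h
  ext z
  rw [ModularForm.SL_slash_apply, zpow_neg, mul_inv_eq_iff_eq_mul₀
    (zpow_ne_zero _ (UpperHalfPlane.denom_ne_zero _ z)), Finset.sum_apply, Finset.sum_apply, sum_mul]
  rw [← Equiv.sum_comp σ (fun i ↦ (heckeE2 l i ^ m * heckeFactor l i ^ w •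
    ((g : ℍ → ℂ) ∘ heckePoint l i)) z * _)]
  refine sum_congr rfl fun i _ ↦ ?_
  obtain ⟨γ, h1, h2, h3⟩ := hσ i z
  have hg : (g : ℍ → ℂ) (γ • heckePoint l (σ i) z) =
      UpperHalfPlane.denom γ (heckePoint l (σ i) z) ^ w * g (heckePoint l (σ i) z) := by
    have := SlashInvariantForm.slash_action_eqn'' g
      (MonoidHom.mem_range.mpr ⟨γ, rfl⟩) (heckePoint l (σ i) z)
    rw [zpow_natCast] at this
    exact this
  have hE : heckeE2 l i (γ₀ • z) = UpperHalfPlane.denom γ₀ z ^ 2 * heckeE2 l (σ i) z := by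
    simp only [heckeE2, Pi.sub_apply, Pi.smul_apply, Function.comp_apply, smul_eq_mul, h1, E2_smul]
    linear_combination (EisensteinSeries.E2 (heckePoint l (σ i) z) *
      (heckeFactor l i * UpperHalfPlane.denom γ (heckePoint l (σ i) z) +
      UpperHalfPlane.denom γ₀ z * heckeFactor l (σ i)) -
      1 / (2 * riemannZeta 2) * (2 * Real.pi * Complex.I) * γ 1 0 * heckeFactor l i) * h2 -
      1 / (2 * riemannZeta 2) * (2 * Real.pi * Complex.I) * UpperHalfPlane.denom γ₀ z * h3
  simp only [Pi.mul_apply, Pi.pow_apply, Pi.smul_apply, Function.comp_apply, smul_eq_mul, hE, h1,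
    hg]
  rw [← mul_assoc (heckeFactor l i ^ w), ← mul_pow, h2, zpow_natCast]
  ring

/-- The modular form `∑ φᵢ ^ m * g|γᵢ`. -/
noncomputable def heckeTrace (l : ℕ) [hl : Fact l.Prime] (m : ℕ) {w : ℕ} (g : ModularForm 𝒮ℒ w) :
    ModularForm 𝒮ℒ ((w + 2 * m : ℕ) : ℤ) where
  toFun := ∑ i, heckeE2 l i ^ m * heckeFactor l i ^ w • (g ∘ heckePoint l i)
  slash_action_eq' := fun _ ⟨γ, hγ⟩ ↦ hγ ▸ SlashInvariantForm.slash_action_generators_SL2Z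
    ((permutesHeckePoints_S l).slash_eq m g) ((permutesHeckePoints_T l).slash_eq m g) γ
  holo' := by
    refine MDifferentiable.sum fun i _ ↦ MDifferentiable.mul (MDifferentiable.pow ?_ _) ?_
    · exact ((mdifferentiable_comp_heckePoint l E2_mdifferentiable i).const_smul
        _).sub (E2_mdifferentiable.const_smul _)
    · exact (mdifferentiable_comp_heckePoint l (ModularFormClass.holo g) i).const_smul _
  bdd_at_cusps' {c} hc := by
    rw [Subgroup.IsArithmetic.isCusp_iff_isCusp_SL2Z] at hc
    rw [OnePoint.isBoundedAt_iff_forall_SL2Z hc]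
    intro γ _
    rw [SlashInvariantForm.slash_action_generators_SL2Z
      ((permutesHeckePoints_S l).slash_eq m g) ((permutesHeckePoints_T l).slash_eq m g)]
    refine sum_mem (S := UpperHalfPlane.boundedAtImInftySubalgebra ℂ) fun i _ ↦
      mul_mem (pow_mem (sub_mem ?_ ?_) _) ?_
    · exact Subalgebra.smul_mem _ (isBoundedAtImInfty_comp_heckePoint l
        EisensteinSeries.isBoundedAtImInfty_E2 i) _
    · exact Subalgebra.smul_mem _ EisensteinSeries.isBoundedAtImInfty_E2 _
    · exact Subalgebra.smul_mem _ (isBoundedAtImInfty_comp_heckePoint l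
        (ModularFormClass.bdd_at_infty g) i) _

/-- The Hecke operator at `l` in weight `k` on functions. -/
noncomputable def heckeFun (l : ℕ) [hl : Fact l.Prime] (k : ℕ) : (ℍ → ℂ) →ₗ[ℂ] (ℍ → ℂ) where
  toFun f := ∑ i, heckeFactor l i ^ k • (f ∘ heckePoint l i)
  map_add' f g := by
    rw [← sum_add_distrib]
    exact sum_congr rfl fun i _ ↦ smul_add _ (f ∘ heckePoint l i) _
  map_smul' a f := by
    rw [RingHom.id_apply, smul_sum]
    exact sum_congr rfl fun i _ ↦ smul_comm _ a (f ∘ heckePoint l i)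

variable (l)

lemma heckeFun_E2_pow_mul (j : ℕ) {w : ℕ} (g : ModularForm 𝒮ℒ w) :
    heckeFun l (w + 2 * j) (EisensteinSeries.E2 ^ j * g) =
      ∑ p ∈ antidiagonal j, ((j.choose p.1 : ℂ) * l ^ p.2) •
        (EisensteinSeries.E2 ^ p.2 * heckeTrace l p.1 g) := by
  have h (p : ℕ × ℕ) : ((j.choose p.1 : ℂ) * l ^ p.2) •
      (EisensteinSeries.E2 ^ p.2 * (heckeTrace l p.1 g : ℍ → ℂ)) =
      ∑ i, (j.choose p.1 : ℂ) • (heckeE2 l i ^ p.1 * ((l : ℂ) • EisensteinSeries.E2) ^ p.2) *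
        heckeFactor l i ^ w • ((g : ℍ → ℂ) ∘ heckePoint l i) := by
    change _ • (_ * ∑ i, heckeE2 l i ^ p.1 * heckeFactor l i ^ w • (g ∘ heckePoint l i)) = _
    rw [mul_sum, smul_sum]
    refine sum_congr rfl fun i _ ↦ ?_
    ext z
    simp
    ring
  simp_rw [h]
  rw [sum_comm]
  refine sum_congr rfl fun i _ ↦ ?_
  rw [← sum_mul]
  have h2 : ∑ p ∈ antidiagonal j, (j.choose p.1 : ℂ) •
      (heckeE2 l i ^ p.1 * ((l : ℂ) • EisensteinSeries.E2) ^ p.2) =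
      (heckeFactor l i ^ 2 • (EisensteinSeries.E2 ∘ heckePoint l i)) ^ j := by
    have := (Commute.all (heckeE2 l i) ((l : ℂ) • EisensteinSeries.E2)).add_pow' j
    rw [heckeE2, sub_add_cancel] at this
    rw [this]
    exact sum_congr rfl fun p _ ↦ Nat.cast_smul_eq_nsmul ℂ _ _
  rw [h2]
  ext z
  simp
  ring

lemma heckeFun_mem_quasimodular {k : ℕ} {f : ℍ → ℂ} (hf : f ∈ quasimodular k) :
    heckeFun l k f ∈ quasimodular k := by
  induction hf using Submodule.span_induction with
  | zero => simp
  | add _ _ _ _ h₁ h₂ => rw [map_add]; exact Submodule.add_mem _ h₁ h₂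
  | smul a _ _ h => rw [map_smul]; exact Submodule.smul_mem _ a h
  | mem f hf =>
    obtain ⟨j, w, g, rfl, rfl⟩ := hf
    rw [heckeFun_E2_pow_mul]
    refine Submodule.sum_mem _ fun p hp ↦ Submodule.smul_mem _ _ ?_
    have := E2_pow_mul_mem_quasimodular p.2 (heckeTrace l p.1 g)
    rwa [show w + 2 * p.1 + 2 * p.2 = w + 2 * j by rw [← mem_antidiagonal.mp hp]; ring] at this

lemma HasQSeries.heckeFun {f : ℍ → ℂ} {c : ℕ → ℂ} (hf : HasQSeries f c) (k : ℕ) :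
    HasQSeries (heckeFun l k f) fun n ↦ l * c (l * n) + l ^ k * if l ∣ n then c (n / l) else 0 := by
  intro z
  have hl0 : (l : ℂ) ≠ 0 := mod_cast hl.1.ne_zero
  have hinj : Function.Injective (l * · : ℕ → ℕ) := fun _ _ h ↦
    Nat.eq_of_mul_eq_mul_left hl.1.pos h
  have h1 : HasSum (fun n ↦ ((l : ℂ) ^ k * if l ∣ n then c (n / l) else 0) *
      Function.Periodic.qParam 1 z ^ n) (l ^ k * f (heckePoint l none z)) := by
    rw [← hinj.hasSum_iff]
    · refine Eq.subst (motive := fun F ↦ HasSum F _) (funext fun n ↦ ?_)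
        ((hf (heckePoint l none z)).mul_left ((l : ℂ) ^ k))
      have : Function.Periodic.qParam 1 (heckePoint l none z) =
          Function.Periodic.qParam 1 z ^ l := by
        rw [coe_heckePoint_none, Function.Periodic.qParam, Function.Periodic.qParam,
          ← Complex.exp_nat_mul]
        congr 1
        ring
      simp [this, Nat.mul_div_cancel_left n hl.1.pos, pow_mul, mul_assoc]
    · intro n hn
      rw [if_neg, mul_zero, zero_mul]
      rintro ⟨m, rfl⟩
      exact hn ⟨m, rfl⟩
  let q : ℂ := Function.Periodic.qParam 1 ((z : ℂ) / l)
  have hq (b : ZMod l) (n : ℕ) : Function.Periodic.qParam 1 (heckePoint l (some b) z) ^ n =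
      q ^ n * ZMod.stdAddChar (b * (n : ZMod l)) := by
    have : b * (n : ZMod l) = ((b.val * n : ℤ) : ZMod l) := by simp
    rw [this, ZMod.stdAddChar_coe, coe_heckePoint_some]
    simp only [q, Function.Periodic.qParam, ← Complex.exp_nat_mul, ← Complex.exp_add]
    congr 1
    push_cast
    field_simp
  have h2 : HasSum (fun n ↦ ((l : ℂ) * c (l * n)) * Function.Periodic.qParam 1 z ^ n)
      (∑ b, f (heckePoint l (some b) z)) := by
    have h3 := hasSum_sum fun (b : ZMod l) (_ : b ∈ univ) ↦ hf (heckePoint l (some b) z)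
    have h4 : (fun n ↦ ∑ b, c n * Function.Periodic.qParam 1 (heckePoint l (some b) z) ^ n) =
        fun n ↦ c n * q ^ n * if l ∣ n then (l : ℂ) else 0 := by
      ext n
      simp_rw [hq, ← mul_assoc]
      rw [← mul_sum, AddChar.sum_mulShift _ (ZMod.isPrimitive_stdAddChar l)]
      simp [ZMod.natCast_eq_zero_iff, ZMod.card]
    rw [h4, ← hinj.hasSum_iff] at h3
    · refine Eq.subst (motive := fun F ↦ HasSum F _) (funext fun n ↦ ?_) h3
      have : q ^ l = Function.Periodic.qParam 1 z := by
        simp only [q, Function.Periodic.qParam, ← Complex.exp_nat_mul]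
        congr 1
        field_simp
      simp [pow_mul, this]
      ring
    · intro n hn
      rw [if_neg, mul_zero]
      rintro ⟨m, rfl⟩
      exact hn ⟨m, rfl⟩
  have h5 : _root_.heckeFun l k f z =
      l ^ k * f (heckePoint l none z) + ∑ b, f (heckePoint l (some b) z) := by
    simp [_root_.heckeFun, Fintype.sum_option, heckeFactor]
  rw [h5, add_comm]
  simpa only [add_mul] using h2.add h1

end HeckeTransform

lemma hecke_mem_quasimodularLattice {l : ℕ} (hl : l.Prime) {k : ℕ} {A : ℤ⟦X⟧}
    (hA : A ∈ quasimodularLattice k) : hecke l k A ∈ quasimodularLattice k := by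
  have : Fact l.Prime := ⟨hl⟩
  obtain ⟨f, hf, hA⟩ := hA
  refine ⟨heckeFun l k f, heckeFun_mem_quasimodular l hf, ?_⟩
  simp only [coeff_hecke]
  push_cast
  exact hA.heckeFun l k

lemma iSup_quasimodularLattice_mul_le :
    (⨆ k, quasimodularLattice k) * (⨆ k, quasimodularLattice k) ≤ ⨆ k, quasimodularLattice k := by
  simp_rw [Submodule.iSup_mul, Submodule.mul_iSup]
  exact iSup_le fun k ↦ iSup_le fun l ↦ Submodule.mul_le.mpr fun A hA B hB ↦
    le_iSup quasimodularLattice (k + l) (mul_mem_quasimodularLattice hA hB)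

lemma one_mem_quasimodularLattice : (1 : ℤ⟦X⟧) ∈ quasimodularLattice 0 := by
  refine ⟨_, coe_mem_quasimodular (w := 0) (1 : ModularForm 𝒮ℒ 0), fun z ↦ ?_⟩
  refine Eq.subst (motive := fun F ↦ HasSum F _) (funext fun n ↦ ?_) (hasSum_ite_eq (0 : ℕ) (1 : ℂ))
  by_cases h : n = 0 <;> simp [PowerSeries.coeff_one, h]

/-- The integral power series some multiple of which is a sum of series of quasimodular forms. -/
noncomputable def quasimodularSubalgebra : Subalgebra ℤ ℤ⟦X⟧ where
  carrier := {A | ∃ D : ℤ, D ≠ 0 ∧ D • A ∈ ⨆ k, quasimodularLattice k}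
  mul_mem' := by
    rintro A B ⟨D, hD, hA⟩ ⟨E, hE, hB⟩
    refine ⟨D * E, mul_ne_zero hD hE, ?_⟩
    rw [← smul_mul_smul_comm]
    exact iSup_quasimodularLattice_mul_le (Submodule.mul_mem_mul hA hB)
  add_mem' := by
    rintro A B ⟨D, hD, hA⟩ ⟨E, hE, hB⟩
    refine ⟨D * E, mul_ne_zero hD hE, ?_⟩
    rw [smul_add]
    refine Submodule.add_mem _ ?_ ?_
    · rw [mul_comm, mul_smul]
      exact Submodule.smul_mem _ E hA
    · rw [mul_smul]
      exact Submodule.smul_mem _ D hB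
  algebraMap_mem' r := by
    refine ⟨1, one_ne_zero, ?_⟩
    rw [one_smul, Algebra.algebraMap_eq_smul_one]
    exact Submodule.smul_mem _ r (le_iSup quasimodularLattice 0 one_mem_quasimodularLattice)

lemma mem_quasimodularSubalgebra_of_smul_mem (c : ℤ) (hc : c ≠ 0) (A : ℤ⟦X⟧)
    (h : c • A ∈ quasimodularSubalgebra) : A ∈ quasimodularSubalgebra := by
  obtain ⟨D, hD, h⟩ := h
  exact ⟨D * c, mul_ne_zero hD hc, by rwa [mul_smul]⟩

lemma sigmaSeries_mem_of_hasQSeries {k s : ℕ} {f : ℍ → ℂ} (hf : f ∈ quasimodular k) {r : ℚ}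
    (hr : r ≠ 0) (h : HasQSeries f fun n ↦ if n = 0 then 1 else r * ArithmeticFunction.sigma s n) :
    sigmaSeries s ∈ quasimodularSubalgebra := by
  have hmem : (r.den : ℤ) • (1 : ℤ⟦X⟧) + r.num • sigmaSeries s ∈ quasimodularLattice k := by
    refine ⟨(r.den : ℂ) • f, Submodule.smul_mem _ _ hf, ?_⟩
    refine Eq.subst (motive := fun F ↦ HasQSeries _ F) (funext fun n ↦ ?_) (h.const_mul r.den)
    have hd : (r.den : ℂ) ≠ 0 := mod_cast r.den_ne_zero
    rw [map_add, map_zsmul, map_zsmul, PowerSeries.coeff_one, sigmaSeries, PowerSeries.coeff_mk]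
    by_cases hn : n = 0
    · simp [hn]
    · have : (r : ℂ) = r.num / r.den := by exact_mod_cast (Rat.num_div_den r).symm
      simp [hn, this]
      field_simp
  have hQ : (r.den : ℤ) • (1 : ℤ⟦X⟧) + r.num • sigmaSeries s ∈ quasimodularSubalgebra :=
    ⟨1, one_ne_zero, by rw [one_smul]; exact le_iSup quasimodularLattice k hmem⟩
  refine mem_quasimodularSubalgebra_of_smul_mem r.num (Rat.num_ne_zero.mpr hr) _ ?_
  have := sub_mem hQ (zsmul_mem (one_mem quasimodularSubalgebra) (r.den : ℤ))
  rwa [add_sub_cancel_left] at this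

lemma bernoulli_two_mul_ne_zero {i : ℕ} (hi : i ≠ 0) : bernoulli (2 * i) ≠ 0 := by
  intro h
  have h2 := riemannZeta_two_mul_nat hi
  rw [h] at h2
  refine riemannZeta_ne_zero_of_one_lt_re ?_ (h2.trans (by simp))
  norm_cast
  omega

lemma sigmaSeries_mem_quasimodularSubalgebra (i : ℕ) :
    sigmaSeries (2 * i + 1) ∈ quasimodularSubalgebra := by
  rcases Nat.eq_zero_or_pos i with rfl | hi
  · have hE : EisensteinSeries.E2 ∈ quasimodular 2 := by
      simpa using! E2_pow_mul_mem_quasimodular 1 (1 : ModularForm 𝒮ℒ 0)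
    refine sigmaSeries_mem_of_hasQSeries hE (r := -24) (by norm_num) fun z ↦ ?_
    simpa [Function.Periodic.qParam] using EisensteinSeries.hasSum_qExpansion_E2 (z := z)
  · have hk : 3 ≤ 2 * (i + 1) := by omega
    refine sigmaSeries_mem_of_hasQSeries (coe_mem_quasimodular (ModularForm.E hk))
      (r := -(2 * (2 * (i + 1) : ℕ) / bernoulli (2 * (i + 1)))) ?_ fun z ↦ ?_
    · have := bernoulli_two_mul_ne_zero i.succ_ne_zero
      rw [neg_ne_zero]
      positivity
    · have h := ModularForm.hasSum_qExpansion (f := ModularForm.E hk) one_pos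
        one_mem_strictPeriods_SL z
      simp_rw [EisensteinSeries.E_qExpansion_coeff hk (even_two_mul _)] at h
      simpa [mul_add] using h

lemma exists_period_of_mem_iSup {N : ℤ} (hN : N ≠ 0) {l : ℕ} (hl : l.Prime)
    (hlN : l.Coprime N.natAbs) {A : ℤ⟦X⟧} (hA : A ∈ ⨆ k, quasimodularLattice k) :
    ∃ p, 0 < p ∧ ∀ j n, ¬ l ∣ n → N ∣ PowerSeries.coeff (l ^ (p * (j + 1) - 1) * n) A := by
  induction hA using Submodule.iSup_induction' with
  | mem k A hA =>
    obtain ⟨p, hp, h⟩ := exists_period_dvd_coeff (k := k) hl (Int.natAbs_ne_zero.mpr hN) hlN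
      (quasimodularLattice_fg k) fun _ ↦ hecke_mem_quasimodularLattice hl
    exact ⟨p, hp, fun j n hn ↦ Int.natAbs_dvd.mp (h A hA j n hn)⟩
  | zero => exact ⟨1, one_pos, fun j n _ ↦ by simp⟩
  | add A B _ _ hA hB =>
    obtain ⟨p, hp, hA⟩ := hA
    obtain ⟨r, hr, hB⟩ := hB
    refine ⟨p * r, mul_pos hp hr, fun j n hn ↦ ?_⟩
    rw [map_add]
    have h1 : p * r * (j + 1) = p * (r * (j + 1) - 1 + 1) := by
      rw [Nat.sub_add_cancel (mul_pos hr j.succ_pos), mul_assoc]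
    have h2 : p * r * (j + 1) = r * (p * (j + 1) - 1 + 1) := by
      rw [Nat.sub_add_cancel (mul_pos hp j.succ_pos), mul_comm p r, mul_assoc]
    refine dvd_add ?_ ?_
    · rw [h1]
      exact hA _ n hn
    · rw [h2]
      exact hB _ n hn

/-- Coefficients of a series in the quasimodular subalgebra vanish modulo `m` on infinitely many
pairwise non-nested progressions. -/
lemma exists_progressions {m : ℕ} (hm : 0 < m) {f : ℕ → ℕ}
    (hf : (PowerSeries.mk fun n ↦ (f n : ℤ)) ∈ quasimodularSubalgebra) :
    ∃ S : Set (ℕ × ℕ), S.Infinite ∧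
      (∀ p ∈ S, p.2 < p.1) ∧
      (∀ p ∈ S, ∀ n : ℕ, m ∣ f (p.1 * n + p.2)) ∧
      (∀ p ∈ S, ∀ q ∈ S, p ≠ q → ¬ AP p ⊆ AP q) := by
  obtain ⟨D, hD, hA⟩ := hf
  have hN : D * m ≠ 0 := mul_ne_zero hD (by exact_mod_cast hm.ne')
  obtain ⟨l, hlN, hl⟩ := Nat.exists_infinite_primes ((D * m).natAbs + 1)
  have hcop : l.Coprime (D * m).natAbs :=
    Nat.coprime_of_lt_prime (Int.natAbs_ne_zero.mpr hN)
    (Nat.lt_of_succ_le hlN) hl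
  obtain ⟨p, hp, h⟩ := exists_period_of_mem_iSup hN hl hcop hA
  let e (j : ℕ) : ℕ := p * (j + 1) - 1
  have he : Function.Injective e := by
    intro i j hij
    have h1 : 0 < p * (i + 1) := mul_pos hp i.succ_pos
    have h2 : 0 < p * (j + 1) := mul_pos hp j.succ_pos
    have h3 : p * (i + 1) = p * (j + 1) := by simp only [e] at hij; omega
    exact Nat.succ_injective (Nat.eq_of_mul_eq_mul_left hp h3)
  have hval (K n : ℕ) : padicValNat l (l ^ (K + 1) * n + l ^ K) = K := by
    have := Fact.mk hl
    have h1 : ¬ l ∣ l * n + 1 := fun hd ↦ hl.one_lt.ne'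
      (Nat.dvd_one.mp ((Nat.dvd_add_right (dvd_mul_right l n)).mp hd))
    rw [pow_succ, mul_assoc, ← Nat.mul_succ, padicValNat.mul (pow_ne_zero _ hl.ne_zero)
      (Nat.succ_ne_zero _), padicValNat.prime_pow, padicValNat.eq_zero_of_not_dvd h1, add_zero]
  refine ⟨Set.range fun j ↦ (l ^ (e j + 1), l ^ e j), Set.infinite_range_of_injective ?_, ?_, ?_, ?_⟩
  · exact fun i j hij ↦ he (Nat.pow_right_injective hl.two_le (congrArg Prod.snd hij))
  · rintro _ ⟨j, rfl⟩
    exact Nat.pow_lt_pow_right hl.one_lt (Nat.lt_succ_self _)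
  · rintro _ ⟨j, rfl⟩ n
    have h1 : ¬ l ∣ l * n + 1 := fun hd ↦ hl.one_lt.ne'
      (Nat.dvd_one.mp ((Nat.dvd_add_right (dvd_mul_right l n)).mp hd))
    have h2 := h j (l * n + 1) h1
    rw [map_zsmul, PowerSeries.coeff_mk, smul_eq_mul] at h2
    have h3 := Int.natCast_dvd_natCast.mp (Int.dvd_of_mul_dvd_mul_left hD h2)
    rwa [show l ^ (e j + 1) * n + l ^ e j = l ^ e j * (l * n + 1) by ring]
  · rintro _ ⟨i, rfl⟩ _ ⟨j, rfl⟩ hij hsub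
    obtain ⟨n, hn⟩ := hsub ⟨0, rfl⟩
    have h1 := hval (e i) 0
    rw [show l ^ (e i + 1) * 0 + l ^ e i = l ^ (e j + 1) * n + l ^ e j from hn, hval] at h1
    exact hij (by simp only [h1])

/-- for positive integers `a` and `m` there are infinitely many pairwise
non-nested arithmetic progressions `t*n + r` on which `M (a; ·)` vanishes mod `m`, and
likewise (with possibly different progressions) for `MO (a; ·)`. -/
theorem M_and_MO_congruences_in_progressions (a m : ℕ) (ha : 0 < a) (hm : 0 < m) :
    (∃ S : Set (ℕ × ℕ), S.Infinite ∧
      (∀ p ∈ S, p.2 < p.1) ∧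
      (∀ p ∈ S, ∀ n : ℕ, m ∣ M a (p.1 * n + p.2)) ∧
      (∀ p ∈ S, ∀ q ∈ S, p ≠ q → ¬ AP p ⊆ AP q)) ∧
    (∃ S : Set (ℕ × ℕ), S.Infinite ∧
      (∀ p ∈ S, p.2 < p.1) ∧
      (∀ p ∈ S, ∀ n : ℕ, m ∣ MO a (p.1 * n + p.2)) ∧
      (∀ p ∈ S, ∀ q ∈ S, p ≠ q → ¬ AP p ⊆ AP q)) :=
  ⟨exists_progressions hm (M_series_mem mem_quasimodularSubalgebra_of_smul_mem
      sigmaSeries_mem_quasimodularSubalgebra a),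
    exists_progressions hm (MO_series_mem mem_quasimodularSubalgebra_of_smul_mem
      sigmaSeries_mem_quasimodularSubalgebra a)⟩
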